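/- arXiv:1610.08193 — 5 statements merged into one kernel-verified Lean document; each statement's English description precedes it below -/
import Mathlib

section
/- Let Ω > 0, ε > 0, δ > 0 be real and C ≥ 0. Then the function F : (0,∞) → ℝ defined by F(λ) = (Ω^δ / (λ Ω^δ + C)) · (1 − exp(−π (λ Ω^δ + C) ε^{−δ})) is strictly decreasing on (0,∞). -/
open Real Filter Topology

theorem Real.strictAntiOn_one_sub_exp_neg_div :
    StrictAntiOn (fun t : ℝ => (1 - Real.exp (-t)) / t) (Set.Ioi 0) := by
  intro s hs t ht hst
  simp only [Set.mem_Ioi] at hs ht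
  have h := strictConvexOn_exp.secant_strict_mono (Set.mem_univ 0) (Set.mem_univ (-t))
    (Set.mem_univ (-s)) (by linarith) (by linarith) (by linarith)
  simp only [Real.exp_zero, sub_zero, div_neg, ← neg_div, neg_sub] at h
  exact h

theorem stmt_2 (Om ε δ C : ℝ) (hOm : 0 < Om) (hε : 0 < ε) (hδ : 0 < δ) (hC : 0 ≤ C) :
    StrictAntiOn (fun lam : ℝ =>
      Om ^ δ / (lam * Om ^ δ + C) *
        (1 - Real.exp (-π * (lam * Om ^ δ + C) * ε ^ (-δ))))
      (Set.Ioi 0) := by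
  have ha : 0 < Om ^ δ := Real.rpow_pos_of_pos hOm δ
  have hk : 0 < π * ε ^ (-δ) := mul_pos Real.pi_pos (Real.rpow_pos_of_pos hε _)
  have hpos : ∀ x : ℝ, 0 < x → 0 < x * Om ^ δ + C := fun x hx => by positivity
  have key : ∀ x : ℝ, 0 < x →
      Om ^ δ / (x * Om ^ δ + C) * (1 - Real.exp (-π * (x * Om ^ δ + C) * ε ^ (-δ))) =
        Om ^ δ * (π * ε ^ (-δ)) * ((1 - Real.exp (-(π * ε ^ (-δ) * (x * Om ^ δ + C)))) /
          (π * ε ^ (-δ) * (x * Om ^ δ + C))) := by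
    intro x hx
    rw [show -π * (x * Om ^ δ + C) * ε ^ (-δ) = -(π * ε ^ (-δ) * (x * Om ^ δ + C)) by ring,
      mul_assoc (Om ^ δ), ← mul_div_assoc (π * ε ^ (-δ)), mul_div_mul_left _ _ hk.ne',
      div_mul_eq_mul_div, mul_div_assoc]
  intro x hx y hy hxy
  simp only [Set.mem_Ioi] at hx hy
  simp only [key x hx, key y hy]
  refine mul_lt_mul_of_pos_left ?_ (mul_pos ha hk)
  refine Real.strictAntiOn_one_sub_exp_neg_div (mul_pos hk (hpos x hx))
    (mul_pos hk (hpos y hy)) ?_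
  gcongr
end

section
/- Let Ω > 0, ε > 0, δ > 0, λ_u > 0 be real and C ≥ 0, and define F(λ) = (Ω^δ / (λ Ω^δ + C)) · (1 − exp(−π (λ Ω^δ + C) ε^{−δ})) for λ > 0. Then the function λ ↦ λ (1 − exp(−λ_u F(λ))) is strictly increasing on (0,∞). -/
open Real Filter Topology

/-- For fixed `g`, the map `x ↦ x (1 - exp (-(g / x)))` is monotone on the positive reals. -/
lemma mul_one_sub_exp_neg_div_le {x y : ℝ} (g : ℝ) (hx : 0 < x) (hxy : x ≤ y) :
    x * (1 - Real.exp (-(g / x))) ≤ y * (1 - Real.exp (-(g / y))) := by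
  have hy : 0 < y := hx.trans_le hxy
  have h := convexOn_exp.2 (Set.mem_univ (-(g / x))) (Set.mem_univ 0)
    (div_nonneg hx.le hy.le) (sub_nonneg.2 ((div_le_one hy).2 hxy)) (add_sub_cancel _ _)
  have e : x / y * -(g / x) = -(g / y) := by field_simp
  simp only [smul_eq_mul, mul_zero, add_zero, Real.exp_zero, mul_one, e] at h
  have h' := mul_le_mul_of_nonneg_left h hy.le
  have e' : y * (x / y * Real.exp (-(g / x)) + (1 - x / y)) =
      x * Real.exp (-(g / x)) + (y - x) := by field_simp
  rw [e'] at h'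
  linarith

/-- The association probability `x ↦ x a / (x a + C) (1 - exp (-b (x a + C)))` is strictly
increasing on the positive reals. -/
lemma mul_div_mul_one_sub_exp_lt {a b C x y : ℝ} (ha : 0 < a) (hb : 0 < b) (hC : 0 ≤ C)
    (hx : 0 < x) (hxy : x < y) :
    x * (a / (x * a + C) * (1 - Real.exp (-(b * (x * a + C))))) <
      y * (a / (y * a + C) * (1 - Real.exp (-(b * (y * a + C))))) := by
  have hy : 0 < y := hx.trans hxy
  have hX : 0 < x * a + C := by positivity
  have hY : 0 < y * a + C := by positivity
  have hXY : x * a + C < y * a + C := by gcongr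
  have hfrac : x * (a / (x * a + C)) ≤ y * (a / (y * a + C)) := by
    rw [← mul_div_assoc, ← mul_div_assoc, div_le_div_iff₀ hX hY]
    nlinarith [mul_le_mul_of_nonneg_right hxy.le (mul_nonneg ha.le hC)]
  have hexp : 1 - Real.exp (-(b * (x * a + C))) < 1 - Real.exp (-(b * (y * a + C))) := by
    gcongr
  have hpos : 0 ≤ 1 - Real.exp (-(b * (x * a + C))) := by
    rw [sub_nonneg, Real.exp_le_one_iff]
    exact neg_nonpos.2 (by positivity)
  rw [← mul_assoc, ← mul_assoc]
  exact mul_lt_mul' hfrac hexp hpos (by positivity)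

theorem stmt_3 (Om ε δ lu C : ℝ) (hOm : 0 < Om) (hε : 0 < ε) (hδ : 0 < δ)
    (hlu : 0 < lu) (hC : 0 ≤ C)
    (F : ℝ → ℝ)
    (hF : ∀ lam : ℝ, F lam = Om ^ δ / (lam * Om ^ δ + C) *
      (1 - Real.exp (-π * (lam * Om ^ δ + C) * ε ^ (-δ)))) :
    StrictMonoOn (fun lam : ℝ => lam * (1 - Real.exp (-(lu * F lam)))) (Set.Ioi 0) := by
  intro x hx y hy hxy
  rw [Set.mem_Ioi] at hx hy
  have hF' (t : ℝ) : F t = Om ^ δ / (t * Om ^ δ + C) *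
      (1 - Real.exp (-(π * ε ^ (-δ) * (t * Om ^ δ + C)))) := by
    rw [hF]
    ring_nf
  have hG : x * F x < y * F y := by
    rw [hF' x, hF' y]
    exact mul_div_mul_one_sub_exp_lt (Real.rpow_pos_of_pos hOm δ)
      (mul_pos Real.pi_pos (Real.rpow_pos_of_pos hε _)) hC hx hxy
  calc x * (1 - Real.exp (-(lu * F x)))
      < x * (1 - Real.exp (-(lu * (y * F y) / x))) := by
        gcongr
        rw [lt_div_iff₀ hx]
        nlinarith
    _ ≤ y * (1 - Real.exp (-(lu * (y * F y) / y))) :=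
        mul_one_sub_exp_neg_div_le _ hx hxy.le
    _ = y * (1 - Real.exp (-(lu * F y))) := by
        rw [mul_left_comm, mul_div_cancel_left₀ _ hy.ne']
end

section
/- Let Ω > 0, ε > 0, δ > 0, λ_u > 0 be real and C ≥ 0, and define F(λ) = (Ω^δ / (λ Ω^δ + C)) · (1 − exp(−π (λ Ω^δ + C) ε^{−δ})) for λ > 0. Then lim_{λ → ∞} λ (1 − exp(−λ_u F(λ))) = λ_u. -/
open Real Filter Topology

/-- If `x * F x → L` as `x → ∞`, then `x * (1 - exp (-(c * F x))) → c * L`. -/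
theorem tendsto_mul_one_sub_exp_neg {F : ℝ → ℝ} {L : ℝ} (c : ℝ)
    (h : Tendsto (fun x => x * F x) atTop (𝓝 L)) :
    Tendsto (fun x => x * (1 - Real.exp (-(c * F x)))) atTop (𝓝 (c * L)) := by
  have hF0 : Tendsto F atTop (𝓝 0) := by
    have h0 : Tendsto (fun x : ℝ => x⁻¹ * (x * F x)) atTop (𝓝 0) := by
      simpa using tendsto_inv_atTop_zero.mul h
    refine h0.congr' ?_
    filter_upwards [eventually_ne_atTop 0] with x hx
    exact inv_mul_cancel_left₀ hx _
  have hcont : ContinuousAt (dslope Real.exp 0) 0 :=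
    continuousAt_dslope_same.2 Real.differentiableAt_exp
  have hg : Tendsto (fun x => dslope Real.exp 0 (-(c * F x))) atTop (𝓝 1) := by
    have harg : Tendsto (fun x => -(c * F x)) atTop (𝓝 0) := by
      simpa using (hF0.const_mul c).neg
    simpa [dslope_same, Function.comp_def] using hcont.tendsto.comp harg
  have hprod := (h.const_mul c).mul hg
  rw [mul_one] at hprod
  refine hprod.congr fun x => ?_
  have hs := sub_smul_dslope Real.exp 0 (-(c * F x))
  simp only [sub_zero, smul_eq_mul, Real.exp_zero] at hs
  linear_combination (-x) * hs

theorem stmt_4 (Om ε δ lu C : ℝ) (hOm : 0 < Om) (hε : 0 < ε) (hδ : 0 < δ)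
    (hlu : 0 < lu) (hC : 0 ≤ C)
    (F : ℝ → ℝ)
    (hF : ∀ lam : ℝ, F lam = Om ^ δ / (lam * Om ^ δ + C) *
      (1 - Real.exp (-π * (lam * Om ^ δ + C) * ε ^ (-δ)))) :
    Tendsto (fun lam : ℝ => lam * (1 - Real.exp (-(lu * F lam)))) atTop (𝓝 lu) := by
  have ha : 0 < Om ^ δ := Real.rpow_pos_of_pos hOm δ
  have hb : 0 < ε ^ (-δ) := Real.rpow_pos_of_pos hε (-δ)
  have hden : Tendsto (fun lam : ℝ => lam * Om ^ δ + C) atTop atTop :=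
    tendsto_atTop_add_const_right _ C (tendsto_id.atTop_mul_const ha)
  have hexp : Tendsto (fun lam : ℝ => Real.exp (-π * (lam * Om ^ δ + C) * ε ^ (-δ)))
      atTop (𝓝 0) :=
    Real.tendsto_exp_atBot.comp
      ((hden.const_mul_atTop_of_neg (neg_lt_zero.2 Real.pi_pos)).atBot_mul_const hb)
  have hfrac : Tendsto (fun lam : ℝ => 1 - C / (lam * Om ^ δ + C)) atTop (𝓝 1) := by
    simpa using (hden.const_div_atTop C).const_sub 1
  have hassoc : Tendsto (fun lam => lam * F lam) atTop (𝓝 1) := by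
    have hprod := hfrac.mul (hexp.const_sub 1)
    rw [sub_zero, mul_one] at hprod
    refine hprod.congr' ?_
    filter_upwards [hden.eventually_gt_atTop 0] with lam hlam
    rw [hF, one_sub_div hlam.ne', add_sub_cancel_right, ← mul_assoc, mul_div_assoc]
  simpa using tendsto_mul_one_sub_exp_neg lu hassoc
end

section
/- Let K ≥ 1 be an integer; for each k ∈ {1,…,K} let λ_k > 0, Ω_k > 0, R_k > 0, P_k > 0, M_k ≥ 1 and let P_C > 0, η ∈ (0,1], λ_u > 0, δ > 0 be real, with Λ := Σ_{j=1}^K λ_j Ω_j^δ. Define 𝒜_k(ε) := 1 − exp(−(λ_u Ω_k^δ/Λ)(1 − exp(−π Λ ε^{−δ}))). Suppose 𝒪_k : (0,∞) → ℝ satisfies lim_{ε→∞} 𝒪_k(ε) = 0 for each k. Then lim_{ε → ∞} [Σ_{k=1}^K λ_k 𝒜_k(ε) (1 − 𝒪_k(ε)) R_k] / [Σ_{k=1}^K λ_k 𝒜_k(ε) (P_k/η + M_k P_C)] = [Σ_{k=1}^K λ_k Ω_k^δ R_k] / [Σ_{k=1}^K λ_k Ω_k^δ (P_k/η + M_k P_C)].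 -/
open Real Filter Topology

lemma tendsto_one_sub_exp_neg_mul_div (c : ℝ) {α : Type*} {l : Filter α} {u : α → ℝ}
    (hu : Tendsto u l (𝓝[≠] 0)) :
    Tendsto (fun x => (1 - Real.exp (-c * u x)) / u x) l (𝓝 c) := by
  have hderiv : HasDerivAt (fun y : ℝ => 1 - Real.exp (-c * y)) c 0 := by
    simpa using ((hasDerivAt_id (0 : ℝ)).const_mul (-c)).exp.const_sub 1
  refine ((hasDerivAt_iff_tendsto_slope.mp hderiv).comp hu).congr fun x => ?_
  simp [slope_def_field]

theorem stmt_13 (K : ℕ) (hK : 1 ≤ K) (lam Om R P M : Fin K → ℝ)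
    (hlam : ∀ k, 0 < lam k) (hOm : ∀ k, 0 < Om k) (hR : ∀ k, 0 < R k)
    (hP : ∀ k, 0 < P k) (hM : ∀ k, 1 ≤ M k)
    (PC η lu δ : ℝ) (hPC : 0 < PC) (hη : η ∈ Set.Ioc (0:ℝ) 1)
    (hlu : 0 < lu) (hδ : 0 < δ)
    (Λ : ℝ) (hΛ : Λ = ∑ j, lam j * Om j ^ δ)
    (A : Fin K → ℝ → ℝ)
    (hA : ∀ k ε, A k ε =
      1 - Real.exp (-(lu * Om k ^ δ / Λ) * (1 - Real.exp (-π * Λ * ε ^ (-δ)))))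
    (O : Fin K → ℝ → ℝ) (hO : ∀ k, Tendsto (O k) atTop (𝓝 0)) :
    Tendsto (fun ε : ℝ =>
      (∑ k, lam k * A k ε * (1 - O k ε) * R k)
      / (∑ k, lam k * A k ε * (P k / η + M k * PC)))
      atTop
      (𝓝 ((∑ k, lam k * Om k ^ δ * R k)
        / (∑ k, lam k * Om k ^ δ * (P k / η + M k * PC)))) := by
  have hΛpos : 0 < Λ := by
    rw [hΛ]
    exact Finset.sum_pos (fun j _ => mul_pos (hlam j) (rpow_pos_of_pos (hOm j) δ))
      ⟨⟨0, hK⟩, Finset.mem_univ _⟩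
  set u : ℝ → ℝ := fun ε => 1 - Real.exp (-π * Λ * ε ^ (-δ)) with hu_def
  have hu_ne : ∀ᶠ ε in atTop, u ε ≠ 0 := by
    filter_upwards [eventually_gt_atTop 0] with ε hε
    have hpos : 0 < π * Λ * ε ^ (-δ) := by positivity
    have hlt : Real.exp (-π * Λ * ε ^ (-δ)) < 1 := Real.exp_lt_one_iff.mpr (by linarith)
    exact (sub_pos.mpr hlt).ne'
  have hu : Tendsto u atTop (𝓝[≠] 0) := by
    refine tendsto_nhdsWithin_iff.mpr ⟨?_, hu_ne⟩
    simpa [hu_def] using (((tendsto_rpow_neg_atTop hδ).const_mul (-π * Λ)).rexp).const_sub 1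
  have hAu (k : Fin K) : Tendsto (fun ε => A k ε / u ε) atTop (𝓝 (lu * Om k ^ δ / Λ)) := by
    simp only [hA]
    exact tendsto_one_sub_exp_neg_mul_div _ hu
  have hnum : Tendsto (fun ε => ∑ k, lam k * (A k ε / u ε) * (1 - O k ε) * R k) atTop
      (𝓝 (∑ k, lam k * (lu * Om k ^ δ / Λ) * (1 - 0) * R k)) :=
    tendsto_finsetSum _ fun k _ =>
      (((hAu k).const_mul _).mul ((hO k).const_sub 1)).mul_const _
  have hden : Tendsto (fun ε => ∑ k, lam k * (A k ε / u ε) * (P k / η + M k * PC)) atTop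
      (𝓝 (∑ k, lam k * (lu * Om k ^ δ / Λ) * (P k / η + M k * PC))) :=
    tendsto_finsetSum _ fun k _ => ((hAu k).const_mul _).mul_const _
  have hden_pos : 0 < ∑ k, lam k * (lu * Om k ^ δ / Λ) * (P k / η + M k * PC) := by
    refine Finset.sum_pos (fun k _ => ?_) ⟨⟨0, hK⟩, Finset.mem_univ _⟩
    have := hlam k
    have := hOm k
    have := hP k
    have : 0 < M k := one_pos.trans_le (hM k)
    have := hη.1
    positivity
  have hlim : (∑ k, lam k * Om k ^ δ * R k) / (∑ k, lam k * Om k ^ δ * (P k / η + M k * PC))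
      = (∑ k, lam k * (lu * Om k ^ δ / Λ) * (1 - 0) * R k)
        / (∑ k, lam k * (lu * Om k ^ δ / Λ) * (P k / η + M k * PC)) := by
    rw [← mul_div_mul_left _ _ (div_pos hlu hΛpos).ne', Finset.mul_sum, Finset.mul_sum]
    congr 1 <;> exact Finset.sum_congr rfl fun k _ => by ring
  rw [hlim]
  refine (hnum.div hden hden_pos.ne').congr' ?_
  filter_upwards [hu_ne] with ε hε
  rw [Pi.div_apply, ← mul_div_mul_left _ _ hε, Finset.mul_sum, Finset.mul_sum]
  congr 1 <;> exact Finset.sum_congr rfl fun k _ => by field_simp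
end

section
/- Let M ≥ 1 be an integer, let x > 0, and set φ_M = (M!)^{−1/M}. Then (1 − e^{−φ_M x})^M ≤ (1/(M−1)!) ∫_0^x v^{M−1} e^{−v} dv ≤ (1 − e^{−x})^M. -/
open Real Filter Topology

/-- The cumulative distribution function of the Gamma law with integer shape `n`, in closed form. -/
noncomputable def erlangCDF (n : ℕ) (x : ℝ) : ℝ :=
  1 - ∑ k ∈ Finset.range n, x ^ k * Real.exp (-x) / (k.factorial : ℝ)

lemma erlangCDF_succ (n : ℕ) (x : ℝ) :
    erlangCDF (n + 1) x = erlangCDF n x - x ^ n * Real.exp (-x) / (n.factorial : ℝ) := by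
  simp only [erlangCDF, Finset.sum_range_succ]
  ring

lemma hasDerivAt_exp_neg_mul (c x : ℝ) :
    HasDerivAt (fun y => Real.exp (-c * y)) (-c * Real.exp (-c * x)) x := by
  have h := ((hasDerivAt_id x).const_mul (-c)).exp
  simp only [id, mul_one] at h
  exact h.congr_deriv (mul_comm _ _)

lemma hasDerivAt_erlangCDF_succ (n : ℕ) (x : ℝ) :
    HasDerivAt (erlangCDF (n + 1)) (x ^ n * Real.exp (-x) / (n.factorial : ℝ)) x := by
  have hexp : HasDerivAt (fun y : ℝ => Real.exp (-y)) (-Real.exp (-x)) x := by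
    simpa using hasDerivAt_exp_neg_mul 1 x
  induction n with
  | zero =>
    have h : erlangCDF (0 + 1) = fun y => 1 - Real.exp (-y) := by
      ext y; simp [erlangCDF]
    rw [h]
    simpa using hexp.const_sub 1
  | succ n ih =>
    have h : erlangCDF (n + 1 + 1) = fun y =>
        erlangCDF (n + 1) y - y ^ (n + 1) * Real.exp (-y) / ((n + 1).factorial : ℝ) :=
      funext (erlangCDF_succ (n + 1))
    rw [h]
    refine (ih.sub (((hasDerivAt_pow (n + 1) x).mul hexp).div_const _)).congr_deriv ?_
    rw [Nat.factorial_succ]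
    push_cast
    have : (n.factorial : ℝ) ≠ 0 := by positivity
    field_simp
    ring

lemma erlangCDF_succ_zero (n : ℕ) : erlangCDF (n + 1) 0 = 0 := by
  simp [erlangCDF, Finset.sum_range_succ']

lemma tendsto_erlangCDF (n : ℕ) : Tendsto (erlangCDF n) atTop (𝓝 1) := by
  have h : Tendsto (fun x : ℝ =>
      ∑ k ∈ Finset.range n, x ^ k * Real.exp (-x) / (k.factorial : ℝ)) atTop
      (𝓝 (∑ k ∈ Finset.range n, 0 / (k.factorial : ℝ))) :=
    tendsto_finsetSum _ fun k _ =>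
      (Real.tendsto_pow_mul_exp_neg_atTop_nhds_zero k).div_const _
  have h1 : Tendsto (erlangCDF n) atTop _ := h.const_sub 1
  simpa using h1

lemma integral_pow_mul_exp_neg (n : ℕ) (x : ℝ) :
    (1 / (n.factorial : ℝ)) * ∫ v in (0:ℝ)..x, v ^ n * Real.exp (-v)
      = erlangCDF (n + 1) x := by
  have h := intervalIntegral.integral_eq_sub_of_hasDerivAt (a := 0) (b := x)
    (fun y _ => hasDerivAt_erlangCDF_succ n y)
    (Continuous.intervalIntegrable (by fun_prop) _ _)
  rw [erlangCDF_succ_zero, sub_zero, intervalIntegral.integral_div] at h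
  rw [← h]
  ring

lemma erlangCDF_succ_le_pow_div (n : ℕ) {x : ℝ} (hx : 0 ≤ x) :
    erlangCDF (n + 1) x ≤ x ^ (n + 1) / ((n + 1).factorial : ℝ) := by
  rw [← integral_pow_mul_exp_neg]
  have h : ∫ v in (0:ℝ)..x, v ^ n * Real.exp (-v) ≤ ∫ v in (0:ℝ)..x, v ^ n := by
    refine intervalIntegral.integral_mono_on hx
      (Continuous.intervalIntegrable (by fun_prop) _ _)
      (Continuous.intervalIntegrable (by fun_prop) _ _) fun v hv => ?_
    exact mul_le_of_le_one_right (pow_nonneg hv.1 n) (Real.exp_le_one_iff.2 (by linarith [hv.1]))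
  rw [integral_pow] at h
  calc _ ≤ (1 / (n.factorial : ℝ)) * ((x ^ (n + 1) - 0 ^ (n + 1)) / (n + 1)) := by gcongr
    _ = _ := by
      rw [Nat.factorial_succ]
      push_cast
      field_simp
      simp

lemma erlangCDF_succ_le (n : ℕ) {x : ℝ} (hx : 0 ≤ x) :
    erlangCDF (n + 1) x ≤ (1 - Real.exp (-x)) ^ (n + 1) := by
  induction n with
  | zero => simp [erlangCDF]
  | succ n ih =>
    have h1 : 0 ≤ 1 - Real.exp (-x) := sub_nonneg.2 (Real.exp_le_one_iff.2 (by linarith))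
    have h2 := mul_le_mul_of_nonneg_right (erlangCDF_succ_le_pow_div n hx) (Real.exp_pos (-x)).le
    calc erlangCDF (n + 1 + 1) x
        = erlangCDF (n + 1) x - x ^ (n + 1) / ((n + 1).factorial : ℝ) * Real.exp (-x) := by
          rw [erlangCDF_succ (n + 1)]; ring
      _ ≤ erlangCDF (n + 1) x * (1 - Real.exp (-x)) := by linarith
      _ ≤ (1 - Real.exp (-x)) ^ (n + 1) * (1 - Real.exp (-x)) := by gcongr
      _ = _ := (pow_succ _ _).symm

lemma integral_exp_neg_mul {a : ℝ} (ha : 0 < a) :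
    ∫ t in (0:ℝ)..1, Real.exp (-a * t) = (1 - Real.exp (-a)) / a := by
  have h := intervalIntegral.integral_eq_sub_of_hasDerivAt (a := 0) (b := 1)
    (fun y _ => (hasDerivAt_exp_neg_mul a y).div_const (-a))
    (Continuous.intervalIntegrable (by fun_prop) _ _)
  have e : ∀ y : ℝ, -a * Real.exp (-a * y) / -a = Real.exp (-a * y) := fun y => by
    field_simp
  simp only [e] at h
  rw [h]
  field_simp
  simp
  ring

/-- Monotonicity in `p` of the `Lᵖ` norm of `t ↦ exp (-t)` on `[0, 1]`. -/
lemma one_sub_exp_neg_div_rpow_le {a b : ℝ} (ha : 0 < a) (hab : a ≤ b) :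
    ((1 - Real.exp (-a)) / a) ^ (b / a) ≤ (1 - Real.exp (-b)) / b := by
  have hb : 0 < b := ha.trans_le hab
  set m := (1 - Real.exp (-a)) / a with hm
  have hm0 : 0 < m := div_pos (sub_pos.2 (Real.exp_lt_one_iff.2 (by linarith))) ha
  have hr : 1 ≤ b / a := (one_le_div ha).2 hab
  have key : ∀ t : ℝ, m ^ (b / a) * (1 + b / a * (Real.exp (-a * t) / m - 1))
      ≤ Real.exp (-b * t) := fun t => by
    have hu : 0 < Real.exp (-a * t) / m := div_pos (Real.exp_pos _) hm0
    have h := one_add_mul_self_le_rpow_one_add (s := Real.exp (-a * t) / m - 1)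
      (by linarith) hr
    rw [add_sub_cancel, Real.div_rpow (Real.exp_pos _).le hm0.le, ← Real.exp_mul] at h
    have e : -a * t * (b / a) = -b * t := by field_simp
    rw [e, le_div_iff₀ (Real.rpow_pos_of_pos hm0 _)] at h
    linarith
  have hint := intervalIntegral.integral_mono (a := (0:ℝ)) (b := 1) (μ := MeasureTheory.volume)
    zero_le_one
    (Continuous.intervalIntegrable (by fun_prop) _ _)
    (Continuous.intervalIntegrable (by fun_prop) _ _) key
  rw [integral_exp_neg_mul hb] at hint
  have hmean : ∫ t in (0:ℝ)..1, m ^ (b / a) * (1 + b / a * (Real.exp (-a * t) / m - 1))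
      = m ^ (b / a) := by
    have hI : IntervalIntegrable (fun t : ℝ => Real.exp (-a * t) / m)
        MeasureTheory.volume 0 1 := Continuous.intervalIntegrable (by fun_prop) _ _
    rw [intervalIntegral.integral_const_mul, intervalIntegral.integral_add (by simp)
      ((hI.sub (by simp)).const_mul _), intervalIntegral.integral_const_mul,
      intervalIntegral.integral_sub hI (by simp), intervalIntegral.integral_div,
      integral_exp_neg_mul ha, ← hm, div_self hm0.ne']
    simp
  rwa [hmean] at hint

/-- A function vanishing at `0` and at infinity which never decreases before it increases
is nonnegative. -/
lemma nonneg_of_hasDerivAt_of_tendsto_zero {f f' : ℝ → ℝ} (hf : ∀ x, HasDerivAt f (f' x) x)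
    (h0 : f 0 = 0) (hlim : Tendsto f atTop (𝓝 0))
    (hsign : ∀ y z, 0 < y → y < z → f' y < 0 → f' z ≤ 0) {x : ℝ} (hx : 0 < x) : 0 ≤ f x := by
  by_contra! hneg
  have hc : Continuous f := continuous_iff_continuousAt.2 fun y => (hf y).continuousAt
  obtain ⟨z, hz, hxz⟩ := ((hlim.eventually (lt_mem_nhds hneg)).and (eventually_gt_atTop x)).exists
  obtain ⟨c, hc1, hc2⟩ := exists_hasDerivAt_eq_slope f f' hx hc.continuousOn fun y _ => hf y
  obtain ⟨d, hd1, hd2⟩ := exists_hasDerivAt_eq_slope f f' hxz hc.continuousOn fun y _ => hf y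
  have h1 : f' c < 0 := by
    rw [hc2]; exact div_neg_of_neg_of_pos (by linarith) (by linarith)
  have h2 : 0 < f' d := by
    rw [hd2]; exact div_pos (by linarith) (by linarith)
  exact (hsign c d hc1.1 (hc1.2.trans hd1.1) h1).not_gt h2

lemma le_erlangCDF_succ (n : ℕ) {φ : ℝ} (hφ : 0 < φ)
    (hφn : φ ^ (n + 1) = ((n + 1).factorial : ℝ)⁻¹) {x : ℝ} (hx : 0 < x) :
    (1 - Real.exp (-φ * x)) ^ (n + 1) ≤ erlangCDF (n + 1) x := by
  set w : ℝ → ℝ := fun y => (1 - Real.exp (-y)) / y with hw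
  have hw0 : ∀ y, 0 < y → 0 < w y := fun y hy =>
    div_pos (sub_pos.2 (Real.exp_lt_one_iff.2 (by linarith))) hy
  set f' : ℝ → ℝ := fun y => y ^ n * Real.exp (-y) / (n.factorial : ℝ) -
    ((n + 1 : ℕ) : ℝ) * (1 - Real.exp (-φ * y)) ^ n * (φ * Real.exp (-φ * y)) with hf'
  have hfac : ∀ y, 0 < y → f' y = (n + 1) * φ * (φ * y) ^ n * Real.exp (-φ * y) *
      (Real.exp (-(1 - φ) * y) - w (φ * y) ^ n) := fun y hy => by
    have hn : (n.factorial : ℝ)⁻¹ = (n + 1) * φ ^ (n + 1) := by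
      rw [hφn, Nat.factorial_succ]
      push_cast
      field_simp
    have hexp : Real.exp (-y) = Real.exp (-φ * y) * Real.exp (-(1 - φ) * y) := by
      rw [← Real.exp_add]; ring_nf
    have hw1 : 1 - Real.exp (-φ * y) = φ * y * w (φ * y) := by
      simp only [hw, neg_mul]
      field_simp
    simp only [hf']
    rw [hw1, mul_pow (φ * y), div_eq_mul_inv, hn, hexp]
    push_cast
    ring
  have hpos : ∀ y, 0 < y → 0 < (n + 1) * φ * (φ * y) ^ n * Real.exp (-φ * y) :=
    fun y hy => by positivity
  have h := nonneg_of_hasDerivAt_of_tendsto_zero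
    (f := fun y => erlangCDF (n + 1) y - (1 - Real.exp (-φ * y)) ^ (n + 1)) (f' := f')
    (fun y => ?_) ?_ ?_ ?_ hx
  · linarith
  · refine ((hasDerivAt_erlangCDF_succ n y).sub
      (((hasDerivAt_exp_neg_mul φ y).const_sub 1).pow (n + 1))).congr_deriv ?_
    simp [hf']
  · simp [erlangCDF_succ_zero]
  · have he : Tendsto (fun y => Real.exp (-φ * y)) atTop (𝓝 0) :=
      Real.tendsto_exp_atBot.comp (tendsto_id.const_mul_atTop_of_neg (neg_lt_zero.2 hφ))
    simpa using (tendsto_erlangCDF (n + 1)).sub ((he.const_sub 1).pow (n + 1))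
  · intro y z hy hyz hneg
    have hz : 0 < z := hy.trans hyz
    rw [hfac y hy] at hneg
    rw [hfac z hz]
    have h1 : Real.exp (-(1 - φ) * y) < w (φ * y) ^ n := by
      have := neg_of_mul_neg_right hneg (hpos y hy).le
      linarith
    have h2 : w (φ * y) ^ (z / y) ≤ w (φ * z) := by
      have := one_sub_exp_neg_div_rpow_le (mul_pos hφ hy)
        (mul_le_mul_of_nonneg_left hyz.le hφ.le)
      rwa [mul_div_mul_left _ _ hφ.ne'] at this
    have h3 : Real.exp (-(1 - φ) * z) ≤ w (φ * z) ^ n := by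
      have hwy := hw0 _ (mul_pos hφ hy)
      calc Real.exp (-(1 - φ) * z) = Real.exp (-(1 - φ) * y) ^ (z / y) := by
            rw [← Real.exp_mul]; congr 1; field_simp
        _ ≤ (w (φ * y) ^ n) ^ (z / y) := by gcongr
        _ = (w (φ * y) ^ (z / y)) ^ n := by
            rw [← Real.rpow_natCast, ← Real.rpow_natCast, ← Real.rpow_mul hwy.le,
              ← Real.rpow_mul hwy.le, mul_comm (n : ℝ)]
        _ ≤ w (φ * z) ^ n := by gcongr
    exact mul_nonpos_of_nonneg_of_nonpos (hpos z hz).le (by linarith)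

theorem stmt_15 (M : ℕ) (hM : 1 ≤ M) (x : ℝ) (hx : 0 < x)
    (φ : ℝ) (hφ : φ = (Nat.factorial M : ℝ) ^ (-(1 / (M:ℝ)))) :
    (1 - Real.exp (-φ * x)) ^ M
        ≤ (1 / (Nat.factorial (M - 1) : ℝ)) *
            ∫ v in (0:ℝ)..x, v ^ (M - 1) * Real.exp (-v)
    ∧ (1 / (Nat.factorial (M - 1) : ℝ)) *
            ∫ v in (0:ℝ)..x, v ^ (M - 1) * Real.exp (-v)
        ≤ (1 - Real.exp (-x)) ^ M := by
  obtain ⟨n, rfl⟩ := Nat.exists_eq_add_of_le' hM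
  rw [Nat.add_sub_cancel, integral_pow_mul_exp_neg]
  have hfac : (0:ℝ) < ((n + 1).factorial : ℝ) := by positivity
  refine ⟨le_erlangCDF_succ n (hφ ▸ Real.rpow_pos_of_pos hfac _) ?_ hx,
    erlangCDF_succ_le n hx.le⟩
  rw [hφ, ← Real.rpow_natCast, ← Real.rpow_mul hfac.le, ← Real.rpow_neg_one]
  congr 1
  field_simp
end
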